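/- Let d ≥ 2, let Ψ ∈ ℂ^d be a unit vector with rank-one projector P = Ψ Ψ†, let 0 < λ < 1, set ν = 1 − λ, and let Ω = P + λ(I − P) and Ω̄ = I − Ω. Let k, N be integers with k ≥ 0 and N ≥ k + 1, and let δ be a real number with B_{N,k}(ν) < δ ≤ 1. For each integer 0 ≤ i ≤ k let T_i be the operator on (ℂ^d)^{⊗(N+1)} acting as Ω on the first N−i tensor factors, as Ω̄ on the next i factors, and as the identity on the last factor, and let S_i be the same operator with the last factor replaced by P. For a permutation-invariant density matrix ρ on (ℂ^d)^{⊗(N+1)}, set p_k(ρ) := ∑_{i=0}^{k} C(N,i) tr(T_i ρ) and f_k(ρ) := ∑_{i=0}^{k} C(N,i) tr(S_i ρ). Define h_z(k,N,λ) := 1 for 0 ≤ z ≤ k and h_z(k,N,λ) := [(N−z+1) B_{z,k}(ν) + z B_{z−1,k}(ν)]/(N+1) for k+1 ≤ z ≤ N+1; define g_z(k,N,λ) := (N−z+1)/(N+1) for 0 ≤ z ≤ k and g_z(k,N,λ) := (N−z+1) B_{z,k}(ν)/(N+1) for k+1 ≤ z ≤ N+1. Let ẑ be the largest integer z ∈ [0,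 N+1] with h_z(k,N,λ) ≥ δ, let κ := (δ − h_{ẑ+1}(k,N,λ))/(h_{ẑ}(k,N,λ) − h_{ẑ+1}(k,N,λ)), and let ζ̃ := (1−κ) g_{ẑ+1}(k,N,λ) + κ g_{ẑ}(k,N,λ). Then the set { f_k(ρ)/p_k(ρ) : ρ a permutation-invariant density matrix on (ℂ^d)^{⊗(N+1)} with p_k(ρ) ≥ δ } has least element ζ̃/δ. In other words, the defensive-QSV fidelity certificate satisfies F^D_λ(k,N,δ) = ζ̃_λ(k,N,δ,ẑ)/δ whenever δ > B_{N,k}(ν). -/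

import Mathlib

open Matrix ComplexOrder

/-- The binomial cumulative distribution function. -/
noncomputable def binomCDF (z k : ℕ) (p : ℝ) : ℝ :=
  ∑ j ∈ Finset.range (k + 1), (z.choose j : ℝ) * p ^ j * (1 - p) ^ (z - j)

/-- The function `h_z(k, N, λ)` from the defensive QSV analysis, where `ν = 1 - λ`. -/
noncomputable def hFun (k N : ℕ) (l : ℝ) (z : ℕ) : ℝ :=
  if z ≤ k then 1
  else (((N : ℝ) - z + 1) * binomCDF z k (1 - l)
        + (z : ℝ) * binomCDF (z - 1) k (1 - l)) / ((N : ℝ) + 1)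

/-- The function `g_z(k, N, λ)` from the defensive QSV analysis, where `ν = 1 - λ`. -/
noncomputable def gFun (k N : ℕ) (l : ℝ) (z : ℕ) : ℝ :=
  if z ≤ k then ((N : ℝ) - z + 1) / ((N : ℝ) + 1)
  else ((N : ℝ) - z + 1) * binomCDF z k (1 - l) / ((N : ℝ) + 1)

/-- The tensor product of a family of `d × d` matrices, as a matrix whose rows and
columns are indexed by functions `Fin n → Fin d`. -/
def tensorFamily {n d : ℕ} (A : Fin n → Matrix (Fin d) (Fin d) ℂ) :
    Matrix (Fin n → Fin d) (Fin n → Fin d) ℂ :=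
  Matrix.of fun f g => ∏ j, A j (f j) (g j)

/-- The operator on `(ℂ^d)^{⊗(N+1)}` acting as `Ω` on the first `N - i` factors,
as `Ω̄ = 1 - Ω` on the next `i` factors, and as `E` on the last factor. -/
def testOp {d : ℕ} (N i : ℕ) (Ω E : Matrix (Fin d) (Fin d) ℂ) :
    Matrix (Fin (N + 1) → Fin d) (Fin (N + 1) → Fin d) ℂ :=
  tensorFamily fun j =>
    if (j : ℕ) < N - i then Ω else if (j : ℕ) < N then 1 - Ω else E

lemma binomCDF_of_le (z k : ℕ) (p : ℝ) (h : z ≤ k) : binomCDF z k p = 1 := by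
  have h1 := add_pow p (1 - p) z
  have h2 : binomCDF z k p = ∑ j ∈ Finset.range (z + 1), (z.choose j : ℝ) * p ^ j * (1 - p) ^ (z - j) := by
    unfold binomCDF
    symm
    apply Finset.sum_subset
    · intro j hj
      simp only [Finset.mem_range] at *
      omega
    · intro j _ hj
      simp only [Finset.mem_range] at hj
      rw [Nat.choose_eq_zero_of_lt (by omega)]
      simp
  rw [h2]
  have h3 : p + (1 - p) = 1 := by ring
  rw [h3, one_pow] at h1
  refine Eq.trans ?_ h1.symm
  refine Finset.sum_congr rfl fun j _ => by ring

lemma binomCDF_succ (z k : ℕ) (p : ℝ) (h : k ≤ z) :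
    binomCDF z k p - binomCDF (z + 1) k p = (z.choose k : ℝ) * p ^ (k + 1) * (1 - p) ^ (z - k) := by
  induction k with
  | zero =>
    simp [binomCDF]
    ring
  | succ k ih =>
    have ih := ih (by omega)
    unfold binomCDF at *
    rw [Finset.sum_range_succ, Finset.sum_range_succ _ (k + 1)]
    have e1 : z - k = (z - (k + 1)) + 1 := by omega
    have e2 : z + 1 - (k + 1) = (z - (k + 1)) + 1 := by omega
    rw [e1] at ih
    rw [e2, Nat.choose_succ_succ]
    push_cast
    linear_combination ih

lemma choose_logconc (z j k : ℕ) (hj : j ≤ k) (hk : k ≤ z) :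
    (z + 1).choose j * z.choose k ≤ z.choose j * (z + 1).choose k := by
  have h1 := Nat.choose_mul_succ_eq z j
  have h2 := Nat.choose_mul_succ_eq z k
  -- z.choose j * (z+1) = (z+1).choose j * (z+1-j)
  have h3 : z + 1 - k ≤ z + 1 - j := by omega
  have h4 : 0 < z + 1 - k := by omega
  have h5 : 0 < z + 1 - j := by omega
  apply Nat.le_of_mul_le_mul_right _ (Nat.mul_pos h4 h5)
  calc (z + 1).choose j * z.choose k * ((z + 1 - k) * (z + 1 - j))
      = ((z + 1).choose j * (z + 1 - j)) * z.choose k * (z + 1 - k) := by ring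
    _ = (z.choose j * (z + 1)) * z.choose k * (z + 1 - k) := by rw [h1]
    _ ≤ (z.choose j * (z + 1)) * z.choose k * (z + 1 - j) := Nat.mul_le_mul_left _ h3
    _ = z.choose j * (z.choose k * (z + 1)) * (z + 1 - j) := by ring
    _ = z.choose j * ((z + 1).choose k * (z + 1 - k)) * (z + 1 - j) := by rw [h2]
    _ = _ := by ring

/-- decrement of the CDF -/
noncomputable def bDec (z k : ℕ) (l : ℝ) : ℝ := (z.choose k : ℝ) * (1 - l) ^ (k + 1) * l ^ (z - k)

lemma bDec_eq (z k : ℕ) (l : ℝ) (h : k ≤ z) :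
    binomCDF z k (1 - l) - binomCDF (z + 1) k (1 - l) = bDec z k l := by
  rw [binomCDF_succ z k _ h, bDec]
  simp

lemma bDec_pos (z k : ℕ) (l : ℝ) (hl0 : 0 < l) (hl1 : l < 1) (h : k ≤ z) : 0 < bDec z k l := by
  unfold bDec
  have : 0 < z.choose k := Nat.choose_pos h
  have h2 : 0 < 1 - l := by linarith
  positivity

lemma binomCDF_pos (z k : ℕ) (l : ℝ) (hl0 : 0 < l) (hl1 : l < 1) : 0 < binomCDF z k (1 - l) := by
  unfold binomCDF
  have h2 : 0 < 1 - l := by linarith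
  rw [Finset.sum_range_succ']
  have : 0 ≤ ∑ j ∈ Finset.range k, (z.choose (j + 1) : ℝ) * (1 - l) ^ (j + 1) * (1 - (1 - l)) ^ (z - (j + 1)) := by
    apply Finset.sum_nonneg
    intro j _
    rw [sub_sub_cancel]
    positivity
  have h3 : 0 < (z.choose 0 : ℝ) * (1 - l) ^ 0 * (1 - (1 - l)) ^ (z - 0) := by
    rw [sub_sub_cancel]
    simp
    positivity
  linarith

lemma ratio_anti (z k : ℕ) (l : ℝ) (hl0 : 0 < l) (hl1 : l < 1) (h : k ≤ z) :
    binomCDF (z + 1) k (1 - l) * bDec z k l ≤ binomCDF z k (1 - l) * bDec (z + 1) k l := by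
  have h2 : 0 < 1 - l := by linarith
  unfold binomCDF bDec
  rw [sub_sub_cancel, Finset.sum_mul, Finset.sum_mul]
  apply Finset.sum_le_sum
  intro j hj
  have hj : j ≤ k := by
    simp only [Finset.mem_range] at hj
    omega
  have e1 : z + 1 - j = (z - j) + 1 := by omega
  have e2 : z + 1 - k = (z - k) + 1 := by omega
  rw [e1, e2]
  have hc : ((z + 1).choose j : ℝ) * z.choose k ≤ z.choose j * (z + 1).choose k := by
    exact_mod_cast choose_logconc z j k hj h
  have hp : 0 ≤ (1 - l) ^ j * l ^ (z - j) * l * ((1 - l) ^ (k + 1) * l ^ (z - k)) := by positivity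
  calc _ = (((z + 1).choose j : ℝ) * z.choose k) * ((1 - l) ^ j * l ^ (z - j) * l * ((1 - l) ^ (k + 1) * l ^ (z - k))) := by ring
    _ ≤ (z.choose j * (z + 1).choose k) * ((1 - l) ^ j * l ^ (z - j) * l * ((1 - l) ^ (k + 1) * l ^ (z - k))) :=
      mul_le_mul_of_nonneg_right hc hp
    _ = _ := by ring

lemma hFun_eq (k N : ℕ) (l : ℝ) (z : ℕ) : hFun k N l z = (((N : ℝ) - z + 1) * binomCDF z k (1 - l)
        + (z : ℝ) * binomCDF (z - 1) k (1 - l)) / ((N : ℝ) + 1) := by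
  unfold hFun
  split_ifs with h
  · rw [binomCDF_of_le z k _ h, binomCDF_of_le (z - 1) k _ (by omega)]
    have : (N : ℝ) + 1 ≠ 0 := by positivity
    field_simp
    ring
  · rfl

lemma gFun_eq (k N : ℕ) (l : ℝ) (z : ℕ) :
    gFun k N l z = ((N : ℝ) - z + 1) * binomCDF z k (1 - l) / ((N : ℝ) + 1) := by
  unfold gFun
  split_ifs with h
  · rw [binomCDF_of_le z k _ h, mul_one]
  · rfl

lemma z_bDec (z k : ℕ) (l : ℝ) (h : k ≤ z) :
    ((z : ℝ) + 1) * bDec z k l * l = ((z : ℝ) + 1 - k) * bDec (z + 1) k l := by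
  have h1 := Nat.choose_mul_succ_eq z k
  have e2 : z + 1 - k = (z - k) + 1 := by omega
  have h2 : (z.choose k : ℝ) * (z + 1) = (z + 1).choose k * ((z : ℝ) + 1 - k) := by
    have : ((z + 1 - k : ℕ) : ℝ) = (z : ℝ) + 1 - k := by
      rw [Nat.cast_sub (by omega)]
      push_cast
      ring
    rw [← this]
    exact_mod_cast h1
  unfold bDec
  rw [e2]
  linear_combination (1 - l) ^ (k + 1) * l ^ (z - k) * l * h2

/-- normalized denominators: `(N+1) (h_z - h_{z+1}) = b_z (N - z + (z-k)/l)`. -/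
lemma hdiff (k N z : ℕ) (l : ℝ) (hl0 : 0 < l) (h : k ≤ z) :
    hFun k N l z - hFun k N l (z + 1) =
      bDec z k l * ((N : ℝ) - z + ((z : ℝ) - k) / l) / ((N : ℝ) + 1) := by
  rw [hFun_eq, hFun_eq]
  have hb := bDec_eq z k l h
  have hn : (N : ℝ) + 1 ≠ 0 := by positivity
  rw [← sub_div]
  congr 1
  have key : (z : ℝ) * (binomCDF (z - 1) k (1 - l) - binomCDF z k (1 - l)) = bDec z k l * (((z : ℝ) - k) / l) := by
    rcases Nat.eq_or_lt_of_le h with rfl | h'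
    · rw [binomCDF_of_le (k - 1) k _ (by omega), binomCDF_of_le k k _ le_rfl]
      simp
    · obtain ⟨y, rfl⟩ : ∃ y, z = y + 1 := ⟨z - 1, by omega⟩
      have := bDec_eq y k l (by omega)
      have h3 := z_bDec y k l (by omega)
      simp only [Nat.add_sub_cancel]
      rw [this]
      push_cast
      field_simp
      linarith
  simp only [Nat.add_sub_cancel]
  push_cast
  linear_combination key + ((N : ℝ) - z) * hb

lemma gdiff (k N z : ℕ) (l : ℝ) (h : k ≤ z) :
    gFun k N l z - gFun k N l (z + 1) =
      (bDec z k l * ((N : ℝ) - z) + binomCDF z k (1 - l)) / ((N : ℝ) + 1) := by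
  rw [gFun_eq, gFun_eq]
  have hb := bDec_eq z k l h
  rw [← sub_div]
  congr 1
  push_cast
  linear_combination ((N : ℝ) - z) * hb

lemma hdiff_pos (k N z : ℕ) (l : ℝ) (hl0 : 0 < l) (hl1 : l < 1) (h : k ≤ z) (hz : z ≤ N) (hN : k + 1 ≤ N) :
    0 < hFun k N l z - hFun k N l (z + 1) := by
  rw [hdiff k N z l hl0 h]
  have hb := bDec_pos z k l hl0 hl1 h
  have h1 : (0 : ℝ) ≤ (N : ℝ) - z := by
    have : (z : ℝ) ≤ N := by exact_mod_cast hz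
    linarith
  have h2 : (0 : ℝ) ≤ (z : ℝ) - k := by
    have : (k : ℝ) ≤ z := by exact_mod_cast h
    linarith
  have h3 : (1 : ℝ) ≤ (N : ℝ) - k := by
    have : (k : ℝ) + 1 ≤ N := by exact_mod_cast hN
    linarith
  have h4 : (z : ℝ) - k ≤ ((z : ℝ) - k) / l := by
    rw [le_div_iff₀ hl0]
    nlinarith
  have : 0 < (N : ℝ) - z + ((z : ℝ) - k) / l := by linarith
  positivity

lemma gdiff_nonneg (k N z : ℕ) (l : ℝ) (hl0 : 0 < l) (hl1 : l < 1) (h : k ≤ z) (hz : z ≤ N) :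
    0 ≤ gFun k N l z - gFun k N l (z + 1) := by
  rw [gdiff k N z l h]
  have hb := bDec_pos z k l hl0 hl1 h
  have hB := binomCDF_pos z k l hl0 hl1
  have h1 : (0 : ℝ) ≤ (N : ℝ) - z := by
    have : (z : ℝ) ≤ N := by exact_mod_cast hz
    linarith
  positivity

lemma slope_step (k N z : ℕ) (l : ℝ) (hl0 : 0 < l) (hl1 : l < 1) (h : k ≤ z) (hz : z + 1 ≤ N) :
    (gFun k N l (z + 1) - gFun k N l (z + 2)) * (hFun k N l z - hFun k N l (z + 1)) ≤
    (gFun k N l z - gFun k N l (z + 1)) * (hFun k N l (z + 1) - hFun k N l (z + 2)) := by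
  rw [hdiff k N z l hl0 h, hdiff k N (z + 1) l hl0 (by omega), gdiff k N z l h,
    gdiff k N (z + 1) l (by omega), div_mul_div_comm, div_mul_div_comm]
  have hb := bDec_pos z k l hl0 hl1 h
  have hb' := bDec_pos (z + 1) k l hl0 hl1 (by omega)
  have hB := binomCDF_pos z k l hl0 hl1
  have hB' := binomCDF_pos (z + 1) k l hl0 hl1
  have hr := ratio_anti z k l hl0 hl1 h
  apply div_le_div_of_nonneg_right _ (by positivity)
  have h1 : (1 : ℝ) ≤ (N : ℝ) - z := by
    have : (z : ℝ) + 1 ≤ N := by exact_mod_cast hz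
    linarith
  have h2 : (0 : ℝ) ≤ (z : ℝ) - k := by
    have : (k : ℝ) ≤ z := by exact_mod_cast h
    linarith
  have hli : 1 ≤ 1 / l := by
    rw [le_div_iff₀ hl0]
    linarith
  push_cast
  generalize bDec z k l = b at *
  generalize bDec (z + 1) k l = b' at *
  generalize binomCDF z k (1 - l) = B at *
  generalize binomCDF (z + 1) k (1 - l) = B' at *
  generalize (N : ℝ) = Nr at *
  generalize (z : ℝ) = zr at *
  have hX : 0 ≤ Nr - zr + (zr - k) / l := by
    have : 0 ≤ (zr - k) / l := by positivity
    linarith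
  have hY : Nr - (zr + 1) + (zr + 1 - k) / l = (Nr - zr + (zr - k) / l) + (1 / l - 1) := by ring
  rw [hY]
  generalize Nr - zr + (zr - k) / l = X at *
  have hZ : (b' * (Nr - (zr + 1)) + B') * b ≤ (b * (Nr - zr) + B) * b' := by nlinarith [mul_pos hb hb']
  calc (b' * (Nr - (zr + 1)) + B') * (b * X) = ((b' * (Nr - (zr + 1)) + B') * b) * X := by ring
    _ ≤ ((b * (Nr - zr) + B) * b') * X := mul_le_mul_of_nonneg_right hZ hX
    _ ≤ ((b * (Nr - zr) + B) * b') * (X + (1 / l - 1)) := by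
      apply mul_le_mul_of_nonneg_left (by linarith)
      have : 0 ≤ Nr - zr := by linarith
      positivity
    _ = _ := by ring

lemma slope_anti (k N : ℕ) (l : ℝ) (hl0 : 0 < l) (hl1 : l < 1) (hN : k + 1 ≤ N) (x y : ℕ)
    (hx : k ≤ x) (hxy : x ≤ y) (hy : y ≤ N) :
    (gFun k N l y - gFun k N l (y + 1)) / (hFun k N l y - hFun k N l (y + 1)) ≤
    (gFun k N l x - gFun k N l (x + 1)) / (hFun k N l x - hFun k N l (x + 1)) := by
  induction y, hxy using Nat.le_induction with
  | base => exact le_rfl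
  | succ y hxy ih =>
    refine le_trans ?_ (ih (by omega))
    rw [div_le_div_iff₀ (hdiff_pos k N _ l hl0 hl1 (by omega) hy hN)
      (hdiff_pos k N _ l hl0 hl1 (by omega) (by omega) hN)]
    exact slope_step k N y l hl0 hl1 (by omega) hy

/-- The supporting line. -/
lemma support_line (k N : ℕ) (l : ℝ) (hl0 : 0 < l) (hl1 : l < 1) (hN : k + 1 ≤ N) (y : ℕ)
    (hky : k ≤ y) (hy : y ≤ N) (a : ℝ)
    (ha : a = (gFun k N l y - gFun k N l (y + 1)) / (hFun k N l y - hFun k N l (y + 1)))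
    (z : ℕ) (hz : z ≤ N + 1) :
    gFun k N l y - a * hFun k N l y ≤ gFun k N l z - a * hFun k N l z := by
  have hdec : ∀ x, k ≤ x → x ≤ y →
      gFun k N l (x + 1) - a * hFun k N l (x + 1) ≤ gFun k N l x - a * hFun k N l x := by
    intro x hx hxy
    have h1 := slope_anti k N l hl0 hl1 hN x y hx hxy hy
    rw [← ha, le_div_iff₀ (hdiff_pos k N _ l hl0 hl1 hx (by omega) hN)] at h1
    linarith
  have hinc : ∀ x, y ≤ x → x ≤ N →
      gFun k N l x - a * hFun k N l x ≤ gFun k N l (x + 1) - a * hFun k N l (x + 1) := by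
    intro x hxy hx
    have h1 := slope_anti k N l hl0 hl1 hN y x hky hxy hx
    rw [← ha, div_le_iff₀ (hdiff_pos k N _ l hl0 hl1 (by omega) (by omega) hN)] at h1
    linarith
  rcases le_total y z with h | h
  · induction z, h using Nat.le_induction with
    | base => exact le_rfl
    | succ x hx ih => exact (ih (by omega)).trans (hinc x hx (by omega))
  · have main : ∀ x, k ≤ x → x ≤ y →
        gFun k N l y - a * hFun k N l y ≤ gFun k N l x - a * hFun k N l x := by
      intro x hx hxy
      have aux : ∀ w, x ≤ w → w ≤ y →
          gFun k N l w - a * hFun k N l w ≤ gFun k N l x - a * hFun k N l x := by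
        intro w hw
        induction w, hw using Nat.le_induction with
        | base => exact fun _ => le_rfl
        | succ v hv ih => exact fun h' => (hdec v (by omega) (by omega)).trans (ih (by omega))
      exact aux y hxy le_rfl
    rcases le_total k z with hk | hk
    · exact main z hk h
    · refine (main k le_rfl hky).trans ?_
      have h1 : hFun k N l z = 1 := by simp [hFun, hk]
      have h2 : hFun k N l k = 1 := by simp [hFun]
      rw [h1, h2]
      have : (z : ℝ) ≤ k := by exact_mod_cast hk
      have h3 : gFun k N l k ≤ gFun k N l z := by
        simp only [gFun, hk, le_refl, if_true]
        gcongr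
      linarith

section tensor

variable {n d : ℕ}

/-- product operator with `R` on the sites of `S` and `P` elsewhere -/
def blockOp (P R : Matrix (Fin d) (Fin d) ℂ) (S : Finset (Fin n)) :
    Matrix (Fin n → Fin d) (Fin n → Fin d) ℂ :=
  tensorFamily fun j => if j ∈ S then R else P

lemma tensorFamily_mul (A B : Fin n → Matrix (Fin d) (Fin d) ℂ) :
    tensorFamily A * tensorFamily B = tensorFamily (fun j => A j * B j) := by
  ext f g
  simp only [tensorFamily, Matrix.mul_apply, Matrix.of_apply]
  rw [Finset.prod_univ_sum]
  simp only [Fintype.piFinset_univ, Finset.prod_mul_distrib]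

lemma tensorFamily_conjTranspose (A : Fin n → Matrix (Fin d) (Fin d) ℂ) :
    (tensorFamily A)ᴴ = tensorFamily (fun j => (A j)ᴴ) := by
  ext f g
  simp [tensorFamily, Matrix.conjTranspose_apply]

lemma tensorFamily_trace (A : Fin n → Matrix (Fin d) (Fin d) ℂ) :
    (tensorFamily A).trace = ∏ j, (A j).trace := by
  simp only [Matrix.trace, Matrix.diag, tensorFamily, Matrix.of_apply]
  rw [Finset.prod_univ_sum]
  simp only [Fintype.piFinset_univ]

lemma tensorFamily_one : tensorFamily (fun _ : Fin n => (1 : Matrix (Fin d) (Fin d) ℂ)) = 1 := by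
  ext f g
  simp only [tensorFamily, Matrix.of_apply, Matrix.one_apply]
  by_cases h : f = g
  · subst h
    simp
  · rw [if_neg h]
    obtain ⟨j, hj⟩ := Function.ne_iff.mp h
    exact Finset.prod_eq_zero (Finset.mem_univ j) (if_neg hj)

lemma prod_mem_ite {M : Type*} [CommMonoid M] (S : Finset (Fin n)) (a b : Fin n → M) :
    (∏ j, if j ∈ S then a j else b j) = (∏ j ∈ S, a j) * ∏ j ∈ Sᶜ, b j := by
  rw [Finset.prod_ite]
  congr 1
  · apply Finset.prod_congr _ (fun _ _ => rfl)
    ext; simp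
  · apply Finset.prod_congr _ (fun _ _ => rfl)
    ext; simp

lemma tensorFamily_expand (P R : Matrix (Fin d) (Fin d) ℂ) (α β : Fin n → ℂ) :
    tensorFamily (fun j => α j • P + β j • R) =
      ∑ S : Finset (Fin n), (∏ j, if j ∈ S then β j else α j) • blockOp P R S := by
  ext f g
  simp only [Matrix.sum_apply, Matrix.smul_apply, blockOp, tensorFamily, Matrix.of_apply,
    Matrix.add_apply, smul_eq_mul]
  rw [show (∏ j, (α j * P (f j) (g j) + β j * R (f j) (g j))) =
    ∏ j, (β j * R (f j) (g j) + α j * P (f j) (g j)) from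
      Finset.prod_congr rfl fun j _ => add_comm _ _]
  rw [Fintype.prod_add]
  refine Finset.sum_congr rfl fun S _ => ?_
  rw [← prod_mem_ite, ← Finset.prod_mul_distrib]
  refine Finset.prod_congr rfl fun j _ => ?_
  split_ifs <;> rfl

lemma blockOp_mul (P R P' R' : Matrix (Fin d) (Fin d) ℂ) (S : Finset (Fin n)) :
    blockOp P R S * blockOp P' R' S = blockOp (P * P') (R * R') S := by
  unfold blockOp
  rw [tensorFamily_mul]
  congr 1
  ext1 j
  split_ifs <;> rfl

lemma blockOp_conjTranspose (P R : Matrix (Fin d) (Fin d) ℂ) (S : Finset (Fin n)) :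
    (blockOp P R S)ᴴ = blockOp Pᴴ Rᴴ S := by
  unfold blockOp
  rw [tensorFamily_conjTranspose]
  congr 1
  ext1 j
  split_ifs <;> rfl

lemma blockOp_posSemidef (P R : Matrix (Fin d) (Fin d) ℂ) (S : Finset (Fin n))
    (hP : Pᴴ * P = P) (hR : Rᴴ * R = R) : (blockOp P R S).PosSemidef := by
  have : blockOp P R S = (blockOp P R S)ᴴ * blockOp P R S := by
    rw [blockOp_conjTranspose, blockOp_mul, hP, hR]
  rw [this]
  exact Matrix.posSemidef_conjTranspose_mul_self _

lemma trace_blockOp_nonneg (P R : Matrix (Fin d) (Fin d) ℂ) (S : Finset (Fin n))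
    (hP : Pᴴ * P = P) (hR : Rᴴ * R = R) (ρ : Matrix (Fin n → Fin d) (Fin n → Fin d) ℂ)
    (hρ : ρ.PosSemidef) : 0 ≤ (blockOp P R S * ρ).trace := by
  have : blockOp P R S = (blockOp P R S)ᴴ * blockOp P R S := by
    rw [blockOp_conjTranspose, blockOp_mul, hP, hR]
  rw [this, Matrix.mul_assoc, Matrix.trace_mul_comm]
  exact (hρ.mul_mul_conjTranspose_same _).trace_nonneg

lemma blockOp_perm (P R : Matrix (Fin d) (Fin d) ℂ) (S S' : Finset (Fin n))
    (π : Equiv.Perm (Fin n)) (h : ∀ j, π j ∈ S' ↔ j ∈ S) (f g : Fin n → Fin d) :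
    blockOp P R S (f ∘ π) (g ∘ π) = blockOp P R S' f g := by
  simp only [blockOp, tensorFamily, Matrix.of_apply, Function.comp]
  refine Eq.trans ?_ (Equiv.prod_comp π (fun j => (if j ∈ S' then R else P) (f j) (g j)))
  refine Finset.prod_congr rfl fun j _ => ?_
  simp only [h]

lemma exists_perm (S S' : Finset (Fin n)) (h : S.card = S'.card) :
    ∃ π : Equiv.Perm (Fin n), ∀ j, π j ∈ S' ↔ j ∈ S := by
  have e : {x // x ∈ S} ≃ {x // x ∈ S'} := Fintype.equivOfCardEq (by simpa using h)
  refine ⟨e.extendSubtype, fun j => ⟨fun hj => ?_, fun hj => e.extendSubtype_mem j hj⟩⟩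
  by_contra hn
  exact e.extendSubtype_not_mem j hn hj

lemma trace_block_card (P R : Matrix (Fin d) (Fin d) ℂ) (S S' : Finset (Fin n))
    (h : S.card = S'.card) (ρ : Matrix (Fin n → Fin d) (Fin n → Fin d) ℂ)
    (hρ : ∀ π : Equiv.Perm (Fin n), ∀ f g : Fin n → Fin d, ρ (f ∘ π) (g ∘ π) = ρ f g) :
    (blockOp P R S * ρ).trace = (blockOp P R S' * ρ).trace := by
  obtain ⟨π, hπ⟩ := exists_perm S S' h
  simp only [Matrix.trace, Matrix.diag, Matrix.mul_apply]
  have hb : Function.Bijective (fun f : Fin n → Fin d => f ∘ π) :=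
    (Equiv.arrowCongr π.symm (Equiv.refl (Fin d))).bijective
  rw [← hb.sum_comp]
  refine Finset.sum_congr rfl fun f _ => ?_
  rw [← hb.sum_comp]
  refine Finset.sum_congr rfl fun g _ => ?_
  rw [hρ, blockOp_perm P R S S' π hπ]

lemma exists_weight (P R : Matrix (Fin d) (Fin d) ℂ) (ρ : Matrix (Fin n → Fin d) (Fin n → Fin d) ℂ)
    (hρ : ∀ π : Equiv.Perm (Fin n), ∀ f g : Fin n → Fin d, ρ (f ∘ π) (g ∘ π) = ρ f g) :
    ∃ w : ℕ → ℂ, ∀ S : Finset (Fin n), (blockOp P R S * ρ).trace = w S.card := by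
  classical
  refine ⟨fun z => if h : ∃ S : Finset (Fin n), S.card = z then
    (blockOp P R h.choose * ρ).trace else 0, fun S => ?_⟩
  have hex : ∃ T : Finset (Fin n), T.card = S.card := ⟨S, rfl⟩
  simp only [dif_pos hex]
  exact trace_block_card P R S _ hex.choose_spec.symm ρ hρ

open Polynomial in
lemma sum_powersetCard_coeff (α β : Fin n → ℂ) (z : ℕ) :
    ∑ S ∈ Finset.powersetCard z (Finset.univ : Finset (Fin n)), (∏ j, if j ∈ S then β j else α j) =
      (∏ j, (C (α j) + C (β j) * X)).coeff z := by
  rw [show (∏ j, (C (α j) + C (β j) * X)) = ∏ j, (C (β j) * X + C (α j)) from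
      Finset.prod_congr rfl fun j _ => add_comm _ _]
  rw [Fintype.prod_add, Polynomial.finsetSum_coeff]
  have hterm : ∀ S : Finset (Fin n),
      ((∏ j ∈ S, C (β j) * X) * ∏ j ∈ Sᶜ, C (α j)).coeff z =
        if S.card = z then (∏ j, if j ∈ S then β j else α j) else 0 := by
    intro S
    rw [prod_mem_ite, Finset.prod_mul_distrib, Finset.prod_const, ← map_prod, ← map_prod,
      show C (∏ j ∈ S, β j) * X ^ S.card * C (∏ j ∈ Sᶜ, α j) =
        C ((∏ j ∈ S, β j) * ∏ j ∈ Sᶜ, α j) * X ^ S.card by rw [C_mul]; ring,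
      coeff_C_mul_X_pow]
    simp only [eq_comm]
  simp only [hterm]
  rw [← Finset.sum_filter]
  refine Finset.sum_congr ?_ fun _ _ => rfl
  ext S
  simp [Finset.mem_powersetCard]

end tensor

open Polynomial in
lemma coeff_G (N i z : ℕ) (l ν : ℂ) :
    (N.choose i : ℂ) * ((C 1 + C l * X) ^ (N - i) * (C ν * X) ^ i : ℂ[X]).coeff z =
      (N.choose z : ℂ) * ((z.choose i : ℂ) * ν ^ i * l ^ (z - i)) := by
  have h1 : ((C 1 + C l * X) ^ (N - i) : ℂ[X]) = ((1 + X) ^ (N - i) : ℂ[X]).comp (C l * X) := by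
    simp
  rw [mul_pow, ← C_pow, show ((C 1 + C l * X) ^ (N - i) * (C (ν ^ i) * X ^ i) : ℂ[X]) =
    C (ν ^ i) * ((C 1 + C l * X) ^ (N - i) * X ^ i) by ring, coeff_C_mul, coeff_mul_X_pow']
  split_ifs with h
  · rw [h1, comp_C_mul_X_coeff, coeff_one_add_X_pow]
    have := Nat.choose_mul (n := N) h
    have h2 : (N.choose z : ℂ) * z.choose i = N.choose i * (N - i).choose (z - i) := by
      exact_mod_cast this
    linear_combination -(ν ^ i * l ^ (z - i)) * h2
  · rw [Nat.choose_eq_zero_of_lt (show z < i by omega)]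
    simp

open Polynomial in
lemma test_prod (N i : ℕ) (hi : i ≤ N) (A B E : ℂ[X]) :
    (∏ j : Fin (N + 1), if (j : ℕ) < N - i then A else if (j : ℕ) < N then B else E) =
      A ^ (N - i) * B ^ i * E := by
  rw [Fin.prod_univ_castSucc]
  congr 1
  · have h0 : (∏ j : Fin N, if ((Fin.castSucc j : Fin (N + 1)) : ℕ) < N - i then A else
        if ((Fin.castSucc j : Fin (N + 1)) : ℕ) < N then B else E) =
        ∏ j : Fin N, (fun m : ℕ => if m < N - i then A else B) (j : ℕ) := by
      refine Finset.prod_congr rfl fun j _ => ?_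
      simp
    rw [h0, Fin.prod_univ_eq_prod_range (fun m : ℕ => if m < N - i then A else B) N]
    have h1 : N = (N - i) + i := by omega
    conv_lhs => rw [h1]
    rw [Finset.prod_range_add]
    congr 1
    · rw [Finset.prod_congr rfl (g := fun _ => A)]
      · simp
      · intro x hx
        simp only [Finset.mem_range] at hx
        rw [if_pos (by omega)]
    · rw [Finset.prod_congr rfl (g := fun _ => B)]
      · simp
      · intro x hx
        rw [if_neg (by omega)]
  · simp

/-- complex coefficient -/
noncomputable def cB (k : ℕ) (l : ℝ) (z : ℕ) : ℂ := (binomCDF z k (1 - l) : ℂ)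

lemma trace_test_expand {d : ℕ} (P Ω : Matrix (Fin d) (Fin d) ℂ) (l : ℝ)
    (hΩ : Ω = P + (l : ℂ) • ((1 : Matrix (Fin d) (Fin d) ℂ) - P)) (k N : ℕ) (hN : k + 1 ≤ N)
    (e : ℂ) (ρ : Matrix (Fin (N + 1) → Fin d) (Fin (N + 1) → Fin d) ℂ) (w : ℕ → ℂ)
    (hw : ∀ S : Finset (Fin (N + 1)), (blockOp P (1 - P) S * ρ).trace = w S.card) :
    ∑ i ∈ Finset.range (k + 1), (N.choose i : ℂ) *
        (testOp N i Ω (P + e • (1 - P)) * ρ).trace =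
      ∑ z ∈ Finset.range (N + 2), w z *
        ((N.choose z : ℂ) * cB k l z + if z = 0 then 0 else e * ((N.choose (z - 1) : ℂ) * cB k l (z - 1))) := by
  have hone : ∀ i ∈ Finset.range (k + 1), (N.choose i : ℂ) *
      (testOp N i Ω (P + e • (1 - P)) * ρ).trace =
      ∑ z ∈ Finset.range (N + 2), w z *
        ((N.choose z : ℂ) * ((z.choose i : ℂ) * (1 - l) ^ i * l ^ (z - i)) +
          if z = 0 then 0 else e * ((N.choose (z - 1) : ℂ) *
            (((z - 1).choose i : ℂ) * (1 - l) ^ i * l ^ (z - 1 - i)))) := by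
    intro i hi
    have hi : i ≤ N := by
      simp only [Finset.mem_range] at hi
      omega
    let α : Fin (N + 1) → ℂ := fun j => if (j : ℕ) < N - i then 1 else if (j : ℕ) < N then 0 else 1
    let β : Fin (N + 1) → ℂ := fun j => if (j : ℕ) < N - i then l else if (j : ℕ) < N then 1 - l else e
    have hT : testOp N i Ω (P + e • (1 - P)) = tensorFamily (fun j => α j • P + β j • (1 - P)) := by
      unfold testOp
      congr 1
      ext1 j
      simp only [α, β]
      split_ifs
      · rw [hΩ, one_smul]
      · rw [hΩ, zero_smul, sub_smul, one_smul]
        abel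
      · rw [one_smul]
    rw [hT, tensorFamily_expand, Finset.sum_mul, Matrix.trace_sum]
    simp only [Matrix.smul_mul, Matrix.trace_smul, hw, smul_eq_mul]
    rw [← Finset.powerset_univ, Finset.sum_powerset, Finset.mul_sum, Finset.card_univ, Fintype.card_fin]
    refine Finset.sum_congr rfl fun z _ => ?_
    have hz : ∑ S ∈ Finset.powersetCard z (Finset.univ : Finset (Fin (N + 1))),
        (∏ j, if j ∈ S then β j else α j) * w S.card =
        (∑ S ∈ Finset.powersetCard z (Finset.univ : Finset (Fin (N + 1))),
        (∏ j, if j ∈ S then β j else α j)) * w z := by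
      rw [Finset.sum_mul]
      refine Finset.sum_congr rfl fun S hS => ?_
      rw [(Finset.mem_powersetCard.mp hS).2]
    rw [hz, sum_powersetCard_coeff]
    have hp : (∏ j, (Polynomial.C (α j) + Polynomial.C (β j) * Polynomial.X)) =
        ((Polynomial.C 1 + Polynomial.C (l : ℂ) * Polynomial.X) ^ (N - i) *
          (Polynomial.C (1 - l : ℂ) * Polynomial.X) ^ i) * (Polynomial.C 1 + Polynomial.C e * Polynomial.X) := by
      rw [← test_prod N i hi]
      refine Finset.prod_congr rfl fun j _ => ?_
      simp only [α, β]
      split_ifs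
      · rfl
      · rw [map_zero, zero_add]
      · rfl
    rw [hp]
    have hG := fun z => coeff_G N i z (l : ℂ) (1 - l)
    generalize ((Polynomial.C 1 + Polynomial.C (l : ℂ) * Polynomial.X) ^ (N - i) *
          (Polynomial.C (1 - l : ℂ) * Polynomial.X) ^ i) = G at hG
    rw [mul_add, map_one, mul_one, Polynomial.coeff_add,
      show G * (Polynomial.C e * Polynomial.X) = Polynomial.C e * (G * Polynomial.X) by ring,
      Polynomial.coeff_C_mul]
    rcases z with _ | z
    · simp only [Polynomial.mul_coeff_zero, Polynomial.coeff_X_zero, if_true]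
      linear_combination w 0 * hG 0
    · rw [Polynomial.coeff_mul_X, if_neg (Nat.succ_ne_zero z), Nat.add_sub_cancel]
      linear_combination w (z + 1) * hG (z + 1) + w (z + 1) * e * hG z
  rw [Finset.sum_congr rfl hone, Finset.sum_comm]
  refine Finset.sum_congr rfl fun z _ => ?_
  rw [← Finset.mul_sum, Finset.sum_add_distrib]
  have hc : ∀ z, ∑ i ∈ Finset.range (k + 1), ((z.choose i : ℂ) * (1 - l) ^ i * l ^ (z - i)) = cB k l z := by
    intro z
    simp [cB, binomCDF]
  congr 2
  · rw [← Finset.mul_sum, hc]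
  · split_ifs
    · simp
    · rw [← Finset.mul_sum, ← Finset.mul_sum, hc]

lemma coef_g (k N z : ℕ) (l : ℝ) (hz : z ≤ N + 1) :
    (N.choose z : ℝ) * binomCDF z k (1 - l) = ((N + 1).choose z : ℝ) * gFun k N l z := by
  have h1 := Nat.choose_mul_succ_eq N z
  have h2 : (N.choose z : ℝ) * (N + 1) = (N + 1).choose z * ((N : ℝ) + 1 - z) := by
    have : ((N + 1 - z : ℕ) : ℝ) = (N : ℝ) + 1 - z := by
      rw [Nat.cast_sub hz]
      push_cast
      ring
    rw [← this]
    exact_mod_cast h1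
  rw [gFun_eq]
  have : (N : ℝ) + 1 ≠ 0 := by positivity
  field_simp
  linear_combination binomCDF z k (1 - l) * h2

lemma coef_h (k N z : ℕ) (l : ℝ) (hz : z ≤ N + 1) :
    (N.choose z : ℝ) * binomCDF z k (1 - l) +
      (if z = 0 then 0 else (N.choose (z - 1) : ℝ) * binomCDF (z - 1) k (1 - l)) =
      ((N + 1).choose z : ℝ) * hFun k N l z := by
  rw [coef_g k N z l hz, hFun_eq, gFun_eq]
  have hn : (N : ℝ) + 1 ≠ 0 := by positivity
  rcases z with _ | z
  · simp
  · rw [if_neg (Nat.succ_ne_zero z)]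
    have h1 := Nat.add_one_mul_choose_eq N z
    have h2 : ((N : ℝ) + 1) * N.choose z = (N + 1).choose (z + 1) * ((z : ℝ) + 1) := by
      exact_mod_cast h1
    simp only [Nat.add_sub_cancel]
    push_cast
    field_simp
    linear_combination binomCDF z k (1 - l) * h2

lemma f_value {d : ℕ} (P Ω : Matrix (Fin d) (Fin d) ℂ) (l : ℝ)
    (hΩ : Ω = P + (l : ℂ) • ((1 : Matrix (Fin d) (Fin d) ℂ) - P)) (k N : ℕ) (hN : k + 1 ≤ N)
    (ρ : Matrix (Fin (N + 1) → Fin d) (Fin (N + 1) → Fin d) ℂ) (w : ℕ → ℂ)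
    (hw : ∀ S : Finset (Fin (N + 1)), (blockOp P (1 - P) S * ρ).trace = w S.card) :
    (∑ i ∈ Finset.range (k + 1), (N.choose i : ℂ) * (testOp N i Ω P * ρ).trace).re =
      ∑ z ∈ Finset.range (N + 2), ((w z).re * (N + 1).choose z) * gFun k N l z := by
  have h := trace_test_expand P Ω l hΩ k N hN 0 ρ w hw
  rw [zero_smul, add_zero] at h
  rw [h, Complex.re_sum]
  refine Finset.sum_congr rfl fun z hz => ?_
  have hz : z ≤ N + 1 := by
    simp only [Finset.mem_range] at hz
    omega
  have hg := coef_g k N z l hz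
  have : ((N.choose z : ℂ) * cB k l z + if z = 0 then 0 else 0 * ((N.choose (z - 1) : ℂ) * cB k l (z - 1)))
      = ((((N + 1).choose z : ℝ) * gFun k N l z : ℝ) : ℂ) := by
    rw [← hg, cB]
    simp
  rw [this, Complex.re_mul_ofReal]
  ring

lemma p_value {d : ℕ} (P Ω : Matrix (Fin d) (Fin d) ℂ) (l : ℝ)
    (hΩ : Ω = P + (l : ℂ) • ((1 : Matrix (Fin d) (Fin d) ℂ) - P)) (k N : ℕ) (hN : k + 1 ≤ N)
    (ρ : Matrix (Fin (N + 1) → Fin d) (Fin (N + 1) → Fin d) ℂ) (w : ℕ → ℂ)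
    (hw : ∀ S : Finset (Fin (N + 1)), (blockOp P (1 - P) S * ρ).trace = w S.card) :
    (∑ i ∈ Finset.range (k + 1), (N.choose i : ℂ) * (testOp N i Ω 1 * ρ).trace).re =
      ∑ z ∈ Finset.range (N + 2), ((w z).re * (N + 1).choose z) * hFun k N l z := by
  have h := trace_test_expand P Ω l hΩ k N hN 1 ρ w hw
  rw [one_smul, add_sub_cancel] at h
  rw [h, Complex.re_sum]
  refine Finset.sum_congr rfl fun z hz => ?_
  have hz : z ≤ N + 1 := by
    simp only [Finset.mem_range] at hz
    omega
  have hg := coef_h k N z l hz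
  have : ((N.choose z : ℂ) * cB k l z + if z = 0 then 0 else 1 * ((N.choose (z - 1) : ℂ) * cB k l (z - 1)))
      = ((((N + 1).choose z : ℝ) * hFun k N l z : ℝ) : ℂ) := by
    rw [← hg, cB, cB]
    split_ifs <;> simp
  rw [this, Complex.re_mul_ofReal]
  ring

lemma trace_value {d : ℕ} (P : Matrix (Fin d) (Fin d) ℂ) (N : ℕ)
    (ρ : Matrix (Fin (N + 1) → Fin d) (Fin (N + 1) → Fin d) ℂ) (w : ℕ → ℂ)
    (hw : ∀ S : Finset (Fin (N + 1)), (blockOp P (1 - P) S * ρ).trace = w S.card) :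
    ρ.trace = ∑ z ∈ Finset.range (N + 2), w z * (N + 1).choose z := by
  have h1 := tensorFamily_expand P (1 - P) (fun _ : Fin (N + 1) => (1 : ℂ)) (fun _ => 1)
  simp only [one_smul, add_sub_cancel, tensorFamily_one, ite_self, Finset.prod_const_one] at h1
  have h2 : ρ.trace = ((1 : Matrix (Fin (N + 1) → Fin d) (Fin (N + 1) → Fin d) ℂ) * ρ).trace := by
    rw [one_mul]
  rw [h2, h1, Finset.sum_mul, Matrix.trace_sum]
  simp only [hw]
  rw [← Finset.powerset_univ, Finset.sum_powerset, Finset.card_univ, Fintype.card_fin]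
  refine Finset.sum_congr rfl fun z _ => ?_
  rw [Finset.sum_congr rfl (g := fun _ => w z)]
  · simp [mul_comm]
  · intro S hS
    rw [(Finset.mem_powersetCard.mp hS).2]

/-- the symmetric state with prescribed weights -/
def symState {d : ℕ} (N : ℕ) (P Q : Matrix (Fin d) (Fin d) ℂ) (u : ℕ → ℝ) :
    Matrix (Fin (N + 1) → Fin d) (Fin (N + 1) → Fin d) ℂ :=
  ∑ S : Finset (Fin (N + 1)), (u S.card : ℂ) • blockOp P Q S

lemma symState_perm {d : ℕ} (N : ℕ) (P Q : Matrix (Fin d) (Fin d) ℂ) (u : ℕ → ℝ)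
    (π : Equiv.Perm (Fin (N + 1))) (f g : Fin (N + 1) → Fin d) :
    symState N P Q u (f ∘ π) (g ∘ π) = symState N P Q u f g := by
  unfold symState
  rw [Matrix.sum_apply, Matrix.sum_apply]
  refine Fintype.sum_equiv π.finsetCongr _ _ fun S => ?_
  simp only [Matrix.smul_apply]
  rw [blockOp_perm P Q S (π.finsetCongr S) π (fun j => by simp)]
  simp

lemma symState_posSemidef {d : ℕ} (N : ℕ) (P R : Matrix (Fin d) (Fin d) ℂ) (u : ℕ → ℝ) (c : ℝ) (hc : 0 ≤ c)
    (hP : Pᴴ * P = P) (hR : Rᴴ * R = R) (hu : ∀ z, 0 ≤ u z) :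
    (symState N P ((c : ℂ) • R) u).PosSemidef := by
  unfold symState
  apply Matrix.posSemidef_sum
  intro S _
  apply Matrix.PosSemidef.smul
  · have : blockOp P ((c : ℂ) • R) S = ((c ^ S.card : ℝ) : ℂ) • blockOp P R S := by
      ext f g
      simp only [blockOp, tensorFamily, Matrix.smul_apply, Matrix.of_apply, smul_eq_mul]
      have h1 : (((c ^ S.card : ℝ)) : ℂ) = ∏ j, if j ∈ S then (c : ℂ) else 1 := by
        rw [prod_mem_ite]
        simp
      rw [h1, ← Finset.prod_mul_distrib]
      refine Finset.prod_congr rfl fun j _ => ?_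
      split_ifs <;> simp
    rw [this]
    apply Matrix.PosSemidef.smul (blockOp_posSemidef P R S hP hR)
    exact_mod_cast pow_nonneg hc _
  · exact_mod_cast hu _

lemma symState_weight {d : ℕ} (N : ℕ) (P Q : Matrix (Fin d) (Fin d) ℂ) (u : ℕ → ℝ)
    (h1 : (P * P).trace = 1) (h2 : P * Q = 0) (h3 : (1 - P) * P = 0) (h4 : ((1 - P) * Q).trace = 1)
    (S : Finset (Fin (N + 1))) :
    (blockOp P (1 - P) S * symState N P Q u).trace = (u S.card : ℂ) := by
  unfold symState
  rw [Finset.mul_sum, Matrix.trace_sum, Finset.sum_eq_single S]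
  · rw [Matrix.mul_smul, Matrix.trace_smul, blockOp_mul, blockOp, tensorFamily_trace,
      Finset.prod_eq_one, smul_eq_mul, mul_one]
    intro j _
    split_ifs
    · exact h4
    · exact h1
  · intro T _ hT
    rw [Matrix.mul_smul, Matrix.trace_smul, blockOp, blockOp, tensorFamily_mul, tensorFamily_trace]
    obtain ⟨j, hj⟩ : ∃ j, ¬ (j ∈ T ↔ j ∈ S) := by
      by_contra hcon
      push Not at hcon
      exact hT (Finset.ext hcon)
    rw [Finset.prod_eq_zero (Finset.mem_univ j), smul_zero]
    by_cases a : j ∈ S <;> by_cases b : j ∈ T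
    · exact absurd (by simp [a, b]) hj
    · simp [a, b, h3]
    · simp [a, b, h2]
    · exact absurd (by simp [a, b]) hj
  · simp

theorem DQSV_fidelity_certificate
    (d : ℕ) (hd : 2 ≤ d) (Ψ : Fin d → ℂ)
    (hΨ : star Ψ ⬝ᵥ Ψ = 1)
    (l : ℝ) (hl0 : 0 < l) (hl1 : l < 1)
    (P Ω : Matrix (Fin d) (Fin d) ℂ)
    (hP : P = Matrix.vecMulVec Ψ (star Ψ))
    (hΩ : Ω = P + (l : ℂ) • ((1 : Matrix (Fin d) (Fin d) ℂ) - P))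
    (k N : ℕ) (hN : k + 1 ≤ N)
    (δ : ℝ) (hδlb : binomCDF N k (1 - l) < δ) (hδ1 : δ ≤ 1)
    (zhat : ℕ) (hzhat₁ : zhat ≤ N + 1) (hzhat₂ : δ ≤ hFun k N l zhat)
    (hzhat₃ : ∀ z : ℕ, z ≤ N + 1 → δ ≤ hFun k N l z → z ≤ zhat)
    (κ ζ : ℝ)
    (hκ : κ = (δ - hFun k N l (zhat + 1)) / (hFun k N l zhat - hFun k N l (zhat + 1)))
    (hζ : ζ = (1 - κ) * gFun k N l (zhat + 1) + κ * gFun k N l zhat) :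
    IsLeast
      { x : ℝ | ∃ ρ : Matrix (Fin (N + 1) → Fin d) (Fin (N + 1) → Fin d) ℂ,
          ρ.PosSemidef ∧ ρ.trace = 1 ∧
          (∀ π : Equiv.Perm (Fin (N + 1)), ∀ f g : Fin (N + 1) → Fin d,
            ρ (f ∘ π) (g ∘ π) = ρ f g) ∧
          δ ≤ (∑ i ∈ Finset.range (k + 1),
                (N.choose i : ℂ) * (testOp N i Ω 1 * ρ).trace).re ∧
          x = (∑ i ∈ Finset.range (k + 1),
                (N.choose i : ℂ) * (testOp N i Ω P * ρ).trace).re /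
              (∑ i ∈ Finset.range (k + 1),
                (N.choose i : ℂ) * (testOp N i Ω 1 * ρ).trace).re }
      (ζ / δ) := by
  
  have hPP : P * P = P := by
    rw [hP, Matrix.vecMulVec_mul_vecMulVec, hΨ, one_smul]
  have hPH : Pᴴ = P := by
    rw [hP, Matrix.conjTranspose_vecMulVec, star_star]
  have hP1 : Pᴴ * P = P := by rw [hPH, hPP]
  have hR1 : (1 - P)ᴴ * (1 - P) = 1 - P := by
    rw [Matrix.conjTranspose_sub, hPH, Matrix.conjTranspose_one, mul_sub, sub_mul, sub_mul, hPP]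
    simp
  have hPtr : P.trace = 1 := by
    rw [hP, Matrix.trace_vecMulVec, dotProduct_comm, hΨ]
  have hk1 : hFun k N l k = 1 := by simp [hFun]
  have hkz : k ≤ zhat := hzhat₃ k (by omega) (by rw [hk1]; exact hδ1)
  have hhN1 : hFun k N l (N + 1) = binomCDF N k (1 - l) := by
    rw [hFun_eq]
    have : (N : ℝ) + 1 ≠ 0 := by positivity
    rw [Nat.add_sub_cancel]
    push_cast
    field_simp
    ring
  have hgN1 : gFun k N l (N + 1) = 0 := by
    rw [gFun_eq]
    push_cast
    simp
  have hBpos := binomCDF_pos N k l hl0 hl1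
  have hδ0 : 0 < δ := by linarith
  have hzN : zhat ≤ N := by
    by_contra hcon
    have : zhat = N + 1 := by omega
    rw [this, hhN1] at hzhat₂
    linarith
  have hlt : hFun k N l (zhat + 1) < δ := by
    by_contra hcon
    have := hzhat₃ (zhat + 1) (by omega) (by linarith)
    omega
  have hD : 0 < hFun k N l zhat - hFun k N l (zhat + 1) := by linarith
  have hκ0 : 0 ≤ κ := by
    rw [hκ]
    apply div_nonneg <;> linarith
  have hκ1 : κ ≤ 1 := by
    rw [hκ, div_le_one hD]
    linarith
  have hκδ : (1 - κ) * hFun k N l (zhat + 1) + κ * hFun k N l zhat = δ := by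
    have : κ * (hFun k N l zhat - hFun k N l (zhat + 1)) = δ - hFun k N l (zhat + 1) := by
      rw [hκ]
      exact div_mul_cancel₀ _ hD.ne'
    linarith
  constructor
  · -- attained
    let u : ℕ → ℝ := fun z =>
      ((if z = zhat + 1 then 1 - κ else 0) + (if z = zhat then κ else 0)) / ((N + 1).choose z : ℝ)
    have hu : ∀ z, 0 ≤ u z := by
      intro z
      simp only [u]
      apply div_nonneg _ (by positivity)
      apply add_nonneg <;> split_ifs <;> linarith
    have hsum : ∀ F : ℕ → ℝ, ∑ z ∈ Finset.range (N + 2), (u z * (N + 1).choose z) * F z =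
        (1 - κ) * F (zhat + 1) + κ * F zhat := by
      intro F
      have : ∀ z ∈ Finset.range (N + 2), (u z * (N + 1).choose z) * F z =
          (if z = zhat + 1 then (1 - κ) * F z else 0) + (if z = zhat then κ * F z else 0) := by
        intro z hz
        have hz : z ≤ N + 1 := by
          simp only [Finset.mem_range] at hz
          omega
        have hc : ((N + 1).choose z : ℝ) ≠ 0 := by
          exact_mod_cast (Nat.choose_pos hz).ne'
        simp only [u]
        rw [div_mul_cancel₀ _ hc, add_mul, ite_mul, ite_mul, zero_mul]
      rw [Finset.sum_congr rfl this, Finset.sum_add_distrib, Finset.sum_ite_eq', Finset.sum_ite_eq',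
        if_pos (by simp; omega), if_pos (by simp; omega)]
    have hd1 : (0 : ℝ) < (d : ℝ) - 1 := by
      have : (2 : ℝ) ≤ d := by exact_mod_cast hd
      linarith
    have hRR : (1 - P) * (1 - P) = 1 - P := by
      rw [mul_sub, sub_mul, sub_mul, hPP]
      simp
    have hw : ∀ S : Finset (Fin (N + 1)),
        (blockOp P (1 - P) S * symState N P (((((d : ℝ) - 1)⁻¹ : ℝ) : ℂ) • (1 - P)) u).trace
          = (fun z => (u z : ℂ)) S.card := by
      apply symState_weight
      · rw [hPP, hPtr]
      · rw [Matrix.mul_smul, mul_sub, hPP]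
        simp
      · rw [sub_mul, hPP]
        simp
      · rw [Matrix.mul_smul, hRR, Matrix.trace_smul, Matrix.trace_sub, hPtr, Matrix.trace_one, Fintype.card_fin]
        rw [show ((d : ℂ) - 1) = (((d : ℝ) - 1 : ℝ) : ℂ) by push_cast; rfl, smul_eq_mul,
          ← Complex.ofReal_mul, inv_mul_cancel₀ hd1.ne', Complex.ofReal_one]
    have hp := p_value P Ω l hΩ k N hN _ (fun z => (u z : ℂ)) hw
    have hf := f_value P Ω l hΩ k N hN _ (fun z => (u z : ℂ)) hw
    have ht := trace_value P N _ (fun z => (u z : ℂ)) hw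
    simp only [Complex.ofReal_re] at hp hf
    rw [hsum] at hp hf
    refine ⟨symState N P (((((d : ℝ) - 1)⁻¹ : ℝ) : ℂ) • (1 - P)) u, ?_, ?_, symState_perm N P _ u, ?_, ?_⟩
    · have := symState_posSemidef N P (1 - P) u ((d : ℝ) - 1)⁻¹ (by positivity) hP1 hR1 hu
      exact this
    · rw [ht]
      have := hsum (fun _ => 1)
      simp only [mul_one] at this
      have h2 : ((∑ z ∈ Finset.range (N + 2), u z * (N + 1).choose z : ℝ) : ℂ) = 1 := by
        rw [this]
        simp
      rw [← h2]
      push_cast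
      rfl
    · rw [hp, hκδ]
    · rw [hp, hf, hκδ, hζ]
  · -- lower bound
    rintro x ⟨ρ, hρ, htr, hperm, hpδ, rfl⟩
    obtain ⟨w, hw⟩ := exists_weight P (1 - P) ρ hperm
    rw [p_value P Ω l hΩ k N hN ρ w hw] at hpδ ⊢
    rw [f_value P Ω l hΩ k N hN ρ w hw]
    have ht := trace_value P N ρ w hw
    rw [htr] at ht
    have ht' : (1 : ℝ) = ∑ z ∈ Finset.range (N + 2), (w z).re * (N + 1).choose z := by
      have := congrArg Complex.re ht
      rw [Complex.re_sum] at this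
      simpa using this
    have hwnn : ∀ z ∈ Finset.range (N + 2), 0 ≤ (w z).re * (N + 1).choose z := by
      intro z hz
      have hz : z ≤ N + 1 := by
        simp only [Finset.mem_range] at hz
        omega
      obtain ⟨S, -, hS⟩ := Finset.exists_subset_card_eq (s := (Finset.univ : Finset (Fin (N + 1)))) (n := z) (by simpa using hz)
      have h1 := trace_blockOp_nonneg P (1 - P) S hP1 hR1 ρ hρ
      rw [hw, hS] at h1
      have := (Complex.le_def.mp h1).1
      simp only [Complex.zero_re] at this
      positivity
    generalize hq : (fun z => (w z).re * ((N + 1).choose z : ℝ)) = q at *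
    have hq' : ∀ z, (w z).re * ((N + 1).choose z : ℝ) = q z := fun z => congrFun hq z
    simp only [hq'] at *
    set a := (gFun k N l zhat - gFun k N l (zhat + 1)) / (hFun k N l zhat - hFun k N l (zhat + 1)) with ha
    have hsup := support_line k N l hl0 hl1 hN zhat hkz hzN a ha
    have ha0 : 0 ≤ a := div_nonneg (gdiff_nonneg k N zhat l hl0 hl1 hkz hzN) hD.le
    have haD : a * (hFun k N l zhat - hFun k N l (zhat + 1)) = gFun k N l zhat - gFun k N l (zhat + 1) :=
      div_mul_cancel₀ _ hD.ne'
    set b := gFun k N l zhat - a * hFun k N l zhat with hb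
    have hb0 : b ≤ 0 := by
      have h1 := hsup (N + 1) le_rfl
      rw [hgN1, hhN1] at h1
      have := mul_nonneg ha0 hBpos.le
      linarith
    have hζ' : ζ = a * δ + b := by
      rw [hζ, ← hκδ, hb]
      linear_combination (1 - κ) * haD
    have hfp : a * (∑ z ∈ Finset.range (N + 2), q z * hFun k N l z) + b ≤
        ∑ z ∈ Finset.range (N + 2), q z * gFun k N l z := by
      have h1 : ∑ z ∈ Finset.range (N + 2), q z * b ≤
          ∑ z ∈ Finset.range (N + 2), q z * (gFun k N l z - a * hFun k N l z) := by
        apply Finset.sum_le_sum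
        intro z hz
        apply mul_le_mul_of_nonneg_left _ (hwnn z hz)
        apply hsup
        simp only [Finset.mem_range] at hz
        omega
      rw [← Finset.sum_mul, ← ht', one_mul] at h1
      have h2 : ∑ z ∈ Finset.range (N + 2), q z * (gFun k N l z - a * hFun k N l z) =
          ∑ z ∈ Finset.range (N + 2), q z * gFun k N l z -
          a * ∑ z ∈ Finset.range (N + 2), q z * hFun k N l z := by
        rw [Finset.mul_sum, ← Finset.sum_sub_distrib]
        refine Finset.sum_congr rfl fun z _ => by ring
      linarith
    generalize (∑ z ∈ Finset.range (N + 2), q z * hFun k N l z) = p at *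
    generalize (∑ z ∈ Finset.range (N + 2), q z * gFun k N l z) = f at *
    have hp0 : 0 < p := by linarith
    rw [div_le_div_iff₀ hδ0 hp0, hζ']
    nlinarith [mul_le_mul_of_nonneg_right hfp hδ0.le, mul_nonneg (neg_nonneg.mpr hb0) (sub_nonneg.mpr hpδ)]
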